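/- Fix an integer n ≥ 1 and λ > 0. Let G₁ and G₂ be independent, each distributed according to the gamma distribution with shape 1/n and scale λ. Then Var(|G₁ − G₂|) = E|G₁ − G₂|² − (E|G₁ − G₂|)² = (2/n − 4/B(1/2, 1/n)²) · λ², where B(x, y) = Γ(x)Γ(y)/Γ(x+y) is the beta function. -/

import Mathlib

open MeasureTheory ProbabilityTheory Real

lemma integral_gammaMeasure {k r : ℝ} (hk : 0 < k) (hr : 0 < r) (g : ℝ → ℝ) :
    ∫ x, g x ∂gammaMeasure k r = ∫ x in Set.Ioi 0, gammaPDFReal k r x * g x := by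
  have hmeas : Measurable (gammaPDF k r) := (measurable_gammaPDFReal k r).ennreal_ofReal
  rw [gammaMeasure, integral_withDensity_eq_integral_toReal_smul hmeas
      (ae_of_all _ fun _ ↦ ENNReal.ofReal_lt_top), ← integral_Ici_eq_integral_Ioi,
    setIntegral_eq_integral_of_forall_compl_eq_zero]
  · simp_rw [gammaPDF, ENNReal.toReal_ofReal (gammaPDFReal_nonneg hk hr _), smul_eq_mul]
  · intro x hx
    simp [gammaPDFReal, show ¬ 0 ≤ x from hx]

lemma integral_pow_gammaMeasure {k r : ℝ} (hk : 0 < k) (hr : 0 < r) (m : ℕ) :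
    ∫ x, x ^ m ∂gammaMeasure k r = Gamma (k + m) / (Gamma k * r ^ m) := by
  rw [integral_gammaMeasure hk hr]
  have hcongr : ∀ x ∈ Set.Ioi (0 : ℝ), gammaPDFReal k r x * x ^ m =
      r ^ k / Gamma k * (x ^ (k + m - 1) * exp (-(r * x))) := by
    intro x (hx : 0 < x)
    rw [gammaPDFReal, if_pos hx.le, show k + m - 1 = k - 1 + m by ring, rpow_add_natCast hx.ne']
    ring
  rw [setIntegral_congr_fun measurableSet_Ioi hcongr, integral_const_mul,
    integral_rpow_mul_exp_neg_mul_Ioi (by positivity) hr, one_div, inv_rpow hr.le,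
    rpow_add_natCast hr.ne']
  field_simp

lemma integrable_pow_gammaMeasure {k r : ℝ} (hk : 0 < k) (hr : 0 < r) (m : ℕ) :
    Integrable (fun x ↦ x ^ m) (gammaMeasure k r) := by
  apply Integrable.of_integral_ne_zero
  rw [integral_pow_gammaMeasure hk hr]
  positivity

lemma integrable_id_gammaMeasure {k r : ℝ} (hk : 0 < k) (hr : 0 < r) :
    Integrable (fun x ↦ x) (gammaMeasure k r) := by
  simpa using integrable_pow_gammaMeasure hk hr 1

lemma integral_id_gammaMeasure {k r : ℝ} (hk : 0 < k) (hr : 0 < r) :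
    ∫ x, x ∂gammaMeasure k r = k / r := by
  have h := integral_pow_gammaMeasure hk hr 1
  simp only [pow_one, Nat.cast_one, Gamma_add_one hk.ne'] at h
  rw [h]
  field_simp

lemma integral_sq_gammaMeasure {k r : ℝ} (hk : 0 < k) (hr : 0 < r) :
    ∫ x, x ^ 2 ∂gammaMeasure k r = k * (k + 1) / r ^ 2 := by
  rw [integral_pow_gammaMeasure hk hr, Nat.cast_ofNat, show k + 2 = k + 1 + 1 by ring,
    Gamma_add_one (by positivity), Gamma_add_one hk.ne']
  field_simp

lemma setIntegral_Ioi_gammaMeasure {k r x : ℝ} (hk : 0 < k) (hr : 0 < r) (hx : 0 < x) :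
    ∫ y in Set.Ioi x, (r * y - k) ∂gammaMeasure k r = x * gammaPDFReal k r x := by
  have hmeas : Measurable (gammaPDF k r) := (measurable_gammaPDFReal k r).ennreal_ofReal
  have := isProbabilityMeasure_gammaMeasure hk hr
  have hint : Integrable (fun y ↦ gammaPDFReal k r y * (r * y - k)) := by
    have h : Integrable (fun y ↦ r * y - k) (gammaMeasure k r) :=
      ((integrable_id_gammaMeasure hk hr).const_mul r).sub (integrable_const k)
    rw [gammaMeasure, integrable_withDensity_iff_integrable_smul' hmeas
      (ae_of_all _ fun _ ↦ ENNReal.ofReal_lt_top)] at h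
    simpa only [gammaPDF, ENNReal.toReal_ofReal (gammaPDFReal_nonneg hk hr _), smul_eq_mul] using h
  rw [gammaMeasure, setIntegral_withDensity_eq_setIntegral_toReal_smul hmeas
      (ae_of_all _ fun _ ↦ ENNReal.ofReal_lt_top) _ measurableSet_Ioi]
  simp_rw [gammaPDF, ENNReal.toReal_ofReal (gammaPDFReal_nonneg hk hr _), smul_eq_mul]
  have hderiv : ∀ y ∈ Set.Ici x, HasDerivAt (fun y ↦ -(r ^ k / Gamma k) * (y ^ k * exp (-r * y)))
      (gammaPDFReal k r y * (r * y - k)) y := by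
    intro y (hy : x ≤ y)
    have hy0 : 0 < y := hx.trans_le hy
    have h := ((hasDerivAt_rpow_const (p := k) (Or.inl hy0.ne')).mul
      ((hasDerivAt_id y).const_mul (-r)).exp).const_mul (-(r ^ k / Gamma k))
    refine h.congr_deriv ?_
    have hyk : y ^ k = y ^ (k - 1) * y := by rw [← rpow_add_one hy0.ne', sub_add_cancel]
    simp only [gammaPDFReal, if_pos hy0.le, id, hyk, neg_mul]
    ring
  have hlim := (tendsto_rpow_mul_exp_neg_mul_atTop_nhds_zero k r hr).const_mul (-(r ^ k / Gamma k))
  rw [integral_Ioi_of_hasDerivAt_of_tendsto' hderiv hint.integrableOn hlim, gammaPDFReal,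
    if_pos hx.le]
  have hxk : x ^ k = x ^ (k - 1) * x := by rw [← rpow_add_one hx.ne', sub_add_cancel]
  rw [hxk, neg_mul r x]
  ring

lemma integral_mul_gammaPDFReal_gammaMeasure {k r : ℝ} (hk : 0 < k) (hr : 0 < r) :
    ∫ x, x * gammaPDFReal k r x ∂gammaMeasure k r =
      Gamma (1 / 2 + k) / (2 * (Gamma (1 / 2) * Gamma k)) := by
  rw [integral_gammaMeasure hk hr]
  have hcongr : ∀ x ∈ Set.Ioi (0 : ℝ), gammaPDFReal k r x * (x * gammaPDFReal k r x) =
      (r ^ k / Gamma k) ^ 2 * (x ^ (2 * k - 1) * exp (-(2 * r * x))) := by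
    intro x (hx : 0 < x)
    rw [gammaPDFReal, if_pos hx.le, show 2 * k - 1 = k - 1 + (k - 1) + 1 by ring,
      rpow_add_one hx.ne', rpow_add hx, show -(2 * r * x) = -(r * x) + -(r * x) by ring, exp_add]
    ring
  rw [setIntegral_congr_fun measurableSet_Ioi hcongr, integral_const_mul,
    integral_rpow_mul_exp_neg_mul_Ioi (by positivity) (by positivity), one_div,
    inv_rpow (by positivity), mul_rpow (by positivity) hr.le, Gamma_one_half_eq]
  have hdup := Real.Gamma_mul_Gamma_add_half k
  rw [rpow_sub two_pos, rpow_one, add_comm k] at hdup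
  have hrk : r ^ (2 * k) = (r ^ k) ^ 2 := by rw [mul_comm, rpow_mul hr.le, rpow_two]
  have hG := Gamma_pos_of_pos hk
  rw [hrk]
  field_simp at hdup ⊢
  linarith

lemma integral_tail_gammaMeasure {k r : ℝ} (hk : 0 < k) (hr : 0 < r) :
    ∫ x, ∫ y in Set.Ioi x, (r * y - k) ∂gammaMeasure k r ∂gammaMeasure k r =
      Gamma (1 / 2 + k) / (2 * (Gamma (1 / 2) * Gamma k)) := by
  rw [← integral_mul_gammaPDFReal_gammaMeasure hk hr, integral_gammaMeasure hk hr,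
    integral_gammaMeasure hk hr]
  refine setIntegral_congr_fun measurableSet_Ioi fun x hx ↦ ?_
  simp only [setIntegral_Ioi_gammaMeasure hk hr hx]

lemma integral_abs_sub_gammaMeasure {k r : ℝ} (hk : 0 < k) (hr : 0 < r) :
    ∫ p : ℝ × ℝ, |p.1 - p.2| ∂((gammaMeasure k r).prod (gammaMeasure k r)) =
      2 / r * (Gamma (1 / 2 + k) / (Gamma (1 / 2) * Gamma k)) := by
  have := isProbabilityMeasure_gammaMeasure hk hr
  have : NullSingletonClass (gammaMeasure k r) := by unfold gammaMeasure; infer_instance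
  set μ := gammaMeasure k r
  set h : ℝ → ℝ := fun x ↦ r * x - k with hh
  have hint : Integrable h μ :=
    ((integrable_id_gammaMeasure hk hr).const_mul r).sub (integrable_const k)
  have hzero : ∫ x, h x ∂μ = 0 := by
    rw [hh, integral_sub ((integrable_id_gammaMeasure hk hr).const_mul r) (integrable_const k),
      integral_const_mul, integral_id_gammaMeasure hk hr, integral_const, probReal_univ, one_smul]
    field_simp
    ring
  have hfst : Integrable (fun p : ℝ × ℝ ↦ h p.1) (μ.prod μ) := hint.comp_fst μ
  have hsnd : Integrable (fun p : ℝ × ℝ ↦ h p.2) (μ.prod μ) := hint.comp_snd μ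
  have hmlt : MeasurableSet {p : ℝ × ℝ | p.2 < p.1} := measurableSet_lt measurable_snd measurable_fst
  have hmle : MeasurableSet {p : ℝ × ℝ | p.1 ≤ p.2} := measurableSet_le measurable_fst measurable_snd
  have hlt : ∫ p, {p : ℝ × ℝ | p.2 < p.1}.indicator (fun p ↦ h p.1) p ∂(μ.prod μ) =
      Gamma (1 / 2 + k) / (2 * (Gamma (1 / 2) * Gamma k)) := by
    rw [integral_prod_symm _ (hfst.indicator hmlt), ← integral_tail_gammaMeasure hk hr]
    refine integral_congr_ae (ae_of_all _ fun y ↦ ?_)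
    exact integral_indicator (f := h) measurableSet_Ioi
  have hle : ∫ p, {p : ℝ × ℝ | p.1 ≤ p.2}.indicator (fun p ↦ h p.2) p ∂(μ.prod μ) =
      Gamma (1 / 2 + k) / (2 * (Gamma (1 / 2) * Gamma k)) := by
    rw [integral_prod _ (hsnd.indicator hmle), ← integral_tail_gammaMeasure hk hr]
    refine integral_congr_ae (ae_of_all _ fun x ↦ ?_)
    exact (integral_indicator (f := h) measurableSet_Ici).trans integral_Ici_eq_integral_Ioi
  have hdecomp : ∀ p : ℝ × ℝ, |p.1 - p.2| = r⁻¹ *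
      (2 * ({p : ℝ × ℝ | p.2 < p.1}.indicator (fun p ↦ h p.1) p +
        {p : ℝ × ℝ | p.1 ≤ p.2}.indicator (fun p ↦ h p.2) p) - (h p.1 + h p.2)) := by
    intro p
    rw [eq_inv_mul_iff_mul_eq₀ hr.ne']
    rcases lt_or_ge p.2 p.1 with hp | hp
    · rw [abs_of_pos (sub_pos.2 hp)]
      simp [hp, hh]
      ring
    · rw [abs_of_nonpos (sub_nonpos.2 hp)]
      simp [hp, hh]
      ring
  simp_rw [hdecomp]
  rw [integral_const_mul,
    integral_sub (((hfst.indicator hmlt).fun_add (hsnd.indicator hmle)).const_mul 2)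
      (hfst.fun_add hsnd),
    integral_const_mul, integral_add (hfst.indicator hmlt) (hsnd.indicator hmle),
    integral_add hfst hsnd, hlt, hle, integral_fun_fst h, integral_fun_snd h, hzero]
  simp only [smul_zero, add_zero, sub_zero]
  field_simp
  ring

lemma integral_sq_sub_gammaMeasure {k r : ℝ} (hk : 0 < k) (hr : 0 < r) :
    ∫ p : ℝ × ℝ, (p.1 - p.2) ^ 2 ∂((gammaMeasure k r).prod (gammaMeasure k r)) =
      2 * k / r ^ 2 := by
  have := isProbabilityMeasure_gammaMeasure hk hr
  set μ := gammaMeasure k r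
  have hid := integrable_id_gammaMeasure hk hr
  have hsq := integrable_pow_gammaMeasure hk hr 2
  have hfst : Integrable (fun p : ℝ × ℝ ↦ p.1 ^ 2) (μ.prod μ) := hsq.comp_fst μ
  have hsnd : Integrable (fun p : ℝ × ℝ ↦ p.2 ^ 2) (μ.prod μ) := hsq.comp_snd μ
  have hmul : Integrable (fun p : ℝ × ℝ ↦ p.1 * p.2) (μ.prod μ) := hid.mul_prod hid
  have hexpand : ∀ p : ℝ × ℝ, (p.1 - p.2) ^ 2 = p.1 ^ 2 + p.2 ^ 2 - 2 * (p.1 * p.2) :=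
    fun p ↦ by ring
  simp_rw [hexpand]
  rw [integral_sub (hfst.fun_add hsnd) (hmul.const_mul 2), integral_add hfst hsnd, integral_const_mul,
    integral_fun_fst (fun x : ℝ ↦ x ^ 2), integral_fun_snd (fun x : ℝ ↦ x ^ 2),
    integral_prod_mul (fun x : ℝ ↦ x) (fun x : ℝ ↦ x), integral_sq_gammaMeasure hk hr,
    integral_id_gammaMeasure hk hr, probReal_univ, one_smul]
  field_simp
  ring

/-- For independent `G₁, G₂` gamma distributed with shape `1/n` and scale `λ` (rate `1/λ`),
`Var(|G₁ - G₂|) = E|G₁ - G₂|² - (E|G₁ - G₂|)² = (2/n - 4/B(1/2,1/n)²)·λ²`. -/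
theorem abs_gamma_diff_variance (n : ℕ) (hn : 1 ≤ n) (lam : ℝ) (hlam : 0 < lam) :
    (∫ p : ℝ × ℝ, |p.1 - p.2| ^ 2
        ∂((gammaMeasure (1 / (n : ℝ)) (1 / lam)).prod (gammaMeasure (1 / (n : ℝ)) (1 / lam))))
      - (∫ p : ℝ × ℝ, |p.1 - p.2|
          ∂((gammaMeasure (1 / (n : ℝ)) (1 / lam)).prod
              (gammaMeasure (1 / (n : ℝ)) (1 / lam)))) ^ 2
      = (2 / (n : ℝ) -
          4 / (Real.Gamma (1 / 2) * Real.Gamma (1 / (n : ℝ)) /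
                Real.Gamma (1 / 2 + 1 / (n : ℝ))) ^ 2) * lam ^ 2 := by
  have hk : 0 < 1 / (n : ℝ) := one_div_pos.2 (Nat.cast_pos.2 hn)
  have hr : 0 < 1 / lam := one_div_pos.2 hlam
  simp_rw [sq_abs]
  rw [integral_sq_sub_gammaMeasure hk hr, integral_abs_sub_gammaMeasure hk hr]
  have hG := Gamma_pos_of_pos hk
  have hG' : 0 < Gamma (1 / 2 + 1 / (n : ℝ)) := Gamma_pos_of_pos (by positivity)
  have hG2 : 0 < Gamma (1 / 2 : ℝ) := Gamma_pos_of_pos (by norm_num)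
  generalize Gamma (1 / (n : ℝ)) = a at *
  generalize Gamma (1 / 2 + 1 / (n : ℝ)) = b at *
  generalize Gamma (1 / 2 : ℝ) = c at *
  field_simp
  ring
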